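/- (Gallagher's theorem.) For every fixed integer k ≥ 1, lim_{h→∞} h^{−k} · Σ* S(h) = 1, where the sum Σ* runs over all k-tuples h = (h_1,…,h_k) of distinct positive integers with h_i ≤ h for all i. -/

import Mathlib

open Filter Topology

noncomputable def nup {k : ℕ} (h : Fin k → ℕ) (p : ℕ) : ℕ :=
  (Set.range fun i => ((h i : ZMod p))).ncard

/-- The `p`-factor `(1 - ν_p(h)/p) * (1 - 1/p)^(-k)` of the singular series. -/
noncomputable def singFactor {k : ℕ} (h : Fin k → ℕ) (p : ℕ) : ℝ :=
  (1 - (nup h p : ℝ) / p) * (1 - 1 / (p : ℝ)) ^ (-(k : ℤ))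

/-- The singular series `S(h) = ∏_p (1 - ν_p(h)/p)(1 - 1/p)^(-k)`. -/
noncomputable def singSeries {k : ℕ} (h : Fin k → ℕ) : ℝ :=
  ∏' p : Nat.Primes, singFactor h (p : ℕ)

/-- The `k`-tuples of distinct positive integers with all entries `≤ H`. -/
def distinctTuples (k H : ℕ) : Finset (Fin k → ℕ) :=
  (Fintype.piFinset fun _ : Fin k => Finset.Icc 1 H).filter Function.Injective

section LocalFactors

theorem one_sub_pow_le_quadratic (k : ℕ) {t : ℝ} (ht : 0 ≤ t) (ht1 : t ≤ 1) :
    (1 - t) ^ k ≤ 1 - k * t + (k : ℝ) ^ 2 * t ^ 2 := by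
  induction k with
  | zero => simp
  | succ k ih =>
    have h1 : 0 ≤ 1 - t := by linarith
    have h2 := mul_le_mul_of_nonneg_right ih h1
    have h3 : 0 ≤ (k : ℝ) ^ 2 * t ^ 3 := by positivity
    have h4 : 0 ≤ ((k : ℝ) + 1) * t ^ 2 := by positivity
    rw [pow_succ]
    push_cast
    nlinarith

theorem abs_local_factor_sub_one_le (k ν : ℕ) {t : ℝ} (ht1 : t ≤ 1 / 2) :
    |(1 - (ν : ℝ) * t) * (1 - t) ^ (-(k : ℤ)) - 1| ≤ 2 ^ k * (|1 - (ν : ℝ) * t - (1 - t) ^ k|) := by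
  have h1 : 0 < 1 - t := by linarith
  have h2 : (0 : ℝ) < (1 - t) ^ k := by positivity
  have h3 : ((1 - t) ^ k)⁻¹ ≤ 2 ^ k := by
    rw [← inv_pow]
    refine pow_le_pow_left₀ (by positivity) ?_ k
    rw [inv_le_comm₀ h1 (by norm_num)]
    linarith
  have h4 : (1 - (ν : ℝ) * t) * (1 - t) ^ (-(k : ℤ)) - 1
      = ((1 - t) ^ k)⁻¹ * (1 - (ν : ℝ) * t - (1 - t) ^ k) := by
    rw [zpow_neg, zpow_natCast]
    field_simp
  rw [h4, abs_mul, abs_of_nonneg (by positivity : (0 : ℝ) ≤ ((1 - t) ^ k)⁻¹)]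
  gcongr

theorem one_sub_mul_le_pow (k : ℕ) {t : ℝ} (ht1 : t ≤ 1) : 1 - k * t ≤ (1 - t) ^ k := by
  have := one_add_mul_le_pow (a := -t) (by linarith) k
  have e : (1 + -t) = 1 - t := by ring
  rw [e] at this
  linarith

theorem nup_le {k : ℕ} (h : Fin k → ℕ) (p : ℕ) : nup h p ≤ k := by
  unfold nup
  rw [← Set.image_univ]
  refine (Set.ncard_image_le Set.finite_univ).trans ?_
  simp

theorem nup_eq_of_injective {k : ℕ} (h : Fin k → ℕ) (p : ℕ)
    (hp : ∀ i j, i ≠ j → ¬ h i ≡ h j [MOD p]) : nup h p = k := by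
  unfold nup
  rw [← Set.image_univ, Set.ncard_image_of_injective]
  · simp
  · intro i j hij
    by_contra hne
    exact hp i j hne ((ZMod.natCast_eq_natCast_iff _ _ _).1 hij)

theorem one_div_prime_le_half {p : ℕ} (hp : p.Prime) : 1 / (p : ℝ) ≤ 1 / 2 :=
  one_div_le_one_div_of_le two_pos (by exact_mod_cast hp.two_le)

theorem abs_singFactor_sub_one_le {k : ℕ} (h : Fin k → ℕ) {p : ℕ} (hp : p.Prime) :
    |singFactor h p - 1| ≤ 2 ^ k * k * (1 / (p : ℝ)) := by
  have ht := one_div_prime_le_half hp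
  have ht0 : 0 ≤ 1 / (p : ℝ) := by positivity
  have h1 := abs_local_factor_sub_one_le k (nup h p) ht
  unfold singFactor
  rw [div_eq_mul_one_div]
  refine h1.trans ?_
  rw [mul_assoc]
  gcongr
  have h2 := one_sub_mul_le_pow k (t := 1 / (p : ℝ)) (by linarith)
  have h3 : (1 - 1 / (p : ℝ)) ^ k ≤ 1 := pow_le_one₀ (by linarith) (by linarith)
  have h4 : (nup h p : ℝ) * (1 / (p : ℝ)) ≤ k * (1 / (p : ℝ)) := by
    gcongr
    exact_mod_cast nup_le h p
  have h5 : 0 ≤ (nup h p : ℝ) * (1 / (p : ℝ)) := by positivity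
  rw [abs_le]
  constructor <;> linarith

theorem abs_singFactor_sub_one_le_of_injective {k : ℕ} (h : Fin k → ℕ) {p : ℕ} (hp : p.Prime)
    (hinj : ∀ i j, i ≠ j → ¬ h i ≡ h j [MOD p]) :
    |singFactor h p - 1| ≤ 2 ^ k * k ^ 2 * (1 / (p : ℝ)) ^ 2 := by
  have ht := one_div_prime_le_half hp
  have ht0 : 0 ≤ 1 / (p : ℝ) := by positivity
  have h1 := abs_local_factor_sub_one_le k (nup h p) ht
  unfold singFactor
  rw [div_eq_mul_one_div]
  refine h1.trans ?_
  rw [mul_assoc, nup_eq_of_injective h p hinj]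
  gcongr
  have h2 := one_sub_mul_le_pow k (t := 1 / (p : ℝ)) (by linarith)
  have h3 := one_sub_pow_le_quadratic k ht0 (by linarith)
  rw [abs_le]
  constructor <;> nlinarith [sq_nonneg ((k : ℝ) * (1 / (p : ℝ)))]

theorem summable_indicator_singFactor_sub_one {k : ℕ} (h : Fin k → ℕ)
    (hinj : Function.Injective h) :
    Summable ({p : ℕ | p.Prime}.indicator fun p => singFactor h p - 1) := by
  have hs : Summable fun p : ℕ => 2 ^ k * (k : ℝ) ^ 2 * (1 / (p : ℝ)) ^ 2 := by
    simp_rw [one_div_pow]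
    exact (Real.summable_one_div_nat_pow.2 one_lt_two).mul_left _
  refine Summable.of_norm_bounded_eventually_nat hs ?_
  filter_upwards [eventually_gt_atTop (∑ i, h i)] with p hp
  by_cases hpp : p.Prime
  · rw [Set.indicator_of_mem (by exact hpp), Real.norm_eq_abs]
    refine abs_singFactor_sub_one_le_of_injective h hpp fun i j hij hmod => hij (hinj ?_)
    have hlt : ∀ i, h i < p := fun i =>
      (Finset.single_le_sum (f := h) (fun _ _ => Nat.zero_le _) (Finset.mem_univ i)).trans_lt hp
    exact Nat.ModEq.eq_of_lt_of_lt hmod (hlt i) (hlt j)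
  · rw [Set.indicator_of_notMem (by exact hpp), norm_zero]
    positivity

theorem prod_range_mulIndicator_prime (f : ℕ → ℝ) (N : ℕ) :
    ∏ n ∈ Finset.range N, {p : ℕ | p.Prime}.mulIndicator f n = ∏ p ∈ N.primesBelow, f p := by
  rw [Nat.primesBelow, Finset.prod_filter]
  exact Finset.prod_congr rfl fun n _ => by simp [Set.mulIndicator_apply]

theorem tendsto_prod_primesBelow_singFactor {k : ℕ} (h : Fin k → ℕ)
    (hinj : Function.Injective h) :
    Tendsto (fun N : ℕ => ∏ p ∈ N.primesBelow, singFactor h p) atTop (𝓝 (singSeries h)) := by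
  have hm := Real.multipliable_one_add_of_summable (summable_indicator_singFactor_sub_one h hinj)
  have he : (fun p => 1 + {p : ℕ | p.Prime}.indicator (fun p => singFactor h p - 1) p)
      = {p : ℕ | p.Prime}.mulIndicator (singFactor h) := by
    funext p
    by_cases hpp : p.Prime <;> simp [hpp]
  rw [he] at hm
  have ht := hm.hasProd.tendsto_prod_nat
  simp_rw [prod_range_mulIndicator_prime] at ht
  have e : singSeries h = ∏' p, {p : ℕ | p.Prime}.mulIndicator (singFactor h) p := by
    unfold singSeries
    exact tprod_subtype {p : ℕ | p.Prime} (singFactor h)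
  rw [e]
  exact ht

end LocalFactors

section ProductInequalities

theorem one_le_prod_one_add {ι : Type*} (s : Finset ι) (x : ι → ℝ) (hx : ∀ i ∈ s, 0 ≤ x i) :
    1 ≤ ∏ i ∈ s, (1 + x i) := by
  calc (1 : ℝ) = ∏ _i ∈ s, 1 := by simp
    _ ≤ _ := Finset.prod_le_prod (fun _ _ => zero_le_one) fun i hi => by linarith [hx i hi]

theorem abs_prod_one_add_sub_one_le {ι : Type*} (s : Finset ι) (a : ι → ℝ) :
    |∏ i ∈ s, (1 + a i) - 1| ≤ ∏ i ∈ s, (1 + |a i|) - 1 := by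
  classical
  induction s using Finset.induction_on with
  | empty => simp
  | insert i s hi ih =>
    rw [Finset.prod_insert hi, Finset.prod_insert hi]
    have e : (1 + a i) * ∏ j ∈ s, (1 + a j) - 1
        = (1 + a i) * (∏ j ∈ s, (1 + a j) - 1) + a i := by ring
    have h1 := abs_add_le ((1 + a i) * (∏ j ∈ s, (1 + a j) - 1)) (a i)
    have h2 : |1 + a i| ≤ 1 + |a i| := by simpa using abs_add_le 1 (a i)
    have h3 := mul_le_mul h2 ih (abs_nonneg _) (by positivity)
    rw [e]
    rw [abs_mul] at h1
    linarith

theorem mul_prod_one_add_sub_one_le {ι : Type*} (s : Finset ι) (b c : ι → ℝ) {L : ℝ}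
    (hL : 1 ≤ L) (hb : ∀ i ∈ s, 0 ≤ b i) (hc : ∀ i ∈ s, L * b i ≤ c i) :
    L * (∏ i ∈ s, (1 + b i) - 1) ≤ ∏ i ∈ s, (1 + c i) - 1 := by
  classical
  induction s using Finset.induction_on with
  | empty => simp
  | insert i s hi ih =>
    rw [Finset.prod_insert hi, Finset.prod_insert hi]
    have hbi := hb i (Finset.mem_insert_self _ _)
    have hci := hc i (Finset.mem_insert_self _ _)
    have hb' : ∀ j ∈ s, 0 ≤ b j := fun j hj => hb j (Finset.mem_insert_of_mem hj)
    have hc' : ∀ j ∈ s, L * b j ≤ c j := fun j hj => hc j (Finset.mem_insert_of_mem hj)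
    have ih := ih hb' hc'
    have hle : ∏ j ∈ s, (1 + b j) ≤ ∏ j ∈ s, (1 + c j) := by
      refine Finset.prod_le_prod (fun j hj => by linarith [hb' j hj]) fun j hj => ?_
      nlinarith [hb' j hj, hc' j hj]
    have h1 : 1 ≤ ∏ j ∈ s, (1 + b j) :=
      one_le_prod_one_add _ _ hb'
    have h2 : L * b i * ∏ j ∈ s, (1 + b j) ≤ c i * ∏ j ∈ s, (1 + c j) := by
      apply mul_le_mul hci hle (by linarith)
      nlinarith
    nlinarith

theorem abs_prod_sub_prod_subset_le {ι : Type*} {s t : Finset ι} (hst : s ⊆ t) (f c : ι → ℝ)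
    {L : ℝ} (hL : 1 ≤ L) (hs : ∀ i ∈ s, |f i - 1| ≤ c i)
    (ht : ∀ i ∈ t, i ∉ s → L * |f i - 1| ≤ c i) :
    L * |∏ i ∈ t, f i - ∏ i ∈ s, f i| ≤ ∏ i ∈ t, (1 + c i) := by
  classical
  have e : ∏ i ∈ t, f i - ∏ i ∈ s, f i
      = (∏ i ∈ s, f i) * (∏ i ∈ t \ s, (1 + (f i - 1)) - 1) := by
    rw [← Finset.prod_sdiff hst]
    simp only [add_sub_cancel]
    ring
  have h1 : |∏ i ∈ s, f i| ≤ ∏ i ∈ s, (1 + c i) := by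
    rw [Finset.abs_prod]
    refine Finset.prod_le_prod (fun _ _ => abs_nonneg _) fun i hi => ?_
    have := hs i hi
    have h3 := abs_add_le (f i - 1) 1
    rw [sub_add_cancel, abs_one] at h3
    linarith
  have h2 := mul_prod_one_add_sub_one_le (t \ s) (fun i => |f i - 1|) c hL
    (fun _ _ => abs_nonneg _)
    (fun i hi => ht i (Finset.mem_sdiff.1 hi).1 (Finset.mem_sdiff.1 hi).2)
  have h3 := abs_prod_one_add_sub_one_le (t \ s) fun i => f i - 1
  rw [e, abs_mul, ← Finset.prod_sdiff hst]
  have h0 : 0 ≤ ∏ i ∈ s, (1 + c i) := (abs_nonneg _).trans h1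
  calc L * (|∏ i ∈ s, f i| * |∏ i ∈ t \ s, (1 + (f i - 1)) - 1|)
      = |∏ i ∈ s, f i| * (L * |∏ i ∈ t \ s, (1 + (f i - 1)) - 1|) := by ring
    _ ≤ (∏ i ∈ s, (1 + c i)) * (L * (∏ i ∈ t \ s, (1 + |f i - 1|) - 1)) := by gcongr
    _ ≤ (∏ i ∈ s, (1 + c i)) * ∏ i ∈ t \ s, (1 + c i) := by
        gcongr
        linarith
    _ = _ := mul_comm _ _

theorem one_add_mul_pow_le {C t : ℝ} (hC : 0 ≤ C) (ht : 0 ≤ t) (ht1 : t ≤ 1) (M : ℕ) :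
    (1 + C * t) ^ M ≤ 1 + (1 + C) ^ M * t := by
  suffices h : (1 + C * t) ^ M ≤ 1 + ((1 + C) ^ M - 1) * t by nlinarith
  induction M with
  | zero => simp
  | succ M ih =>
    have h1 : 1 ≤ (1 + C) ^ M := one_le_pow₀ (by linarith)
    have h2 := mul_le_mul_of_nonneg_right ih (by positivity : 0 ≤ 1 + C * t)
    rw [pow_succ, pow_succ]
    have h3 : 0 ≤ ((1 + C) ^ M - 1) * C * (t * (1 - t)) := by
      apply mul_nonneg (mul_nonneg (by linarith) hC) (mul_nonneg ht (by linarith))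
    nlinarith

theorem prod_le_one_add_sum_pow {ι : Type*} (s : Finset ι) (x : ι → ℝ) (hx : ∀ i ∈ s, 1 ≤ x i) :
    ∏ i ∈ s, x i ≤ 1 + ∑ i ∈ s, x i ^ s.card := by
  rcases s.eq_empty_or_nonempty with rfl | hs
  · simp
  · obtain ⟨m, hm, hmax⟩ := s.exists_max_image x hs
    have h1 : ∏ i ∈ s, x i ≤ ∏ _i ∈ s, x m :=
      Finset.prod_le_prod (fun i hi => by linarith [hx i hi]) hmax
    rw [Finset.prod_const] at h1
    have h2 : x m ^ s.card ≤ ∑ i ∈ s, x i ^ s.card :=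
      Finset.single_le_sum (f := fun i => x i ^ s.card)
        (fun i hi => pow_nonneg (by linarith [hx i hi]) _) hm
    linarith

theorem one_add_sum_le_prod_one_add {ι : Type*} (s : Finset ι) (x : ι → ℝ)
    (hx : ∀ i ∈ s, 0 ≤ x i) : 1 + ∑ i ∈ s, x i ≤ ∏ i ∈ s, (1 + x i) := by
  classical
  induction s using Finset.induction_on with
  | empty => simp
  | insert i s hi ih =>
    have hx' : ∀ j ∈ s, 0 ≤ x j := fun j hj => hx j (Finset.mem_insert_of_mem hj)
    rw [Finset.prod_insert hi, Finset.sum_insert hi]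
    have h0 := hx i (Finset.mem_insert_self _ _)
    have h1 : 1 ≤ ∏ j ∈ s, (1 + x j) :=
      one_le_prod_one_add _ _ hx'
    nlinarith [ih hx']

end ProductInequalities

section Counting

theorem card_filter_piFinset_pair {k : ℕ} {i j : Fin k} (hij : i ≠ j) {s : Finset ℕ} {a b : ℕ}
    (ha : a ∈ s) (hb : b ∈ s) :
    s.card ^ 2 * ((Fintype.piFinset fun _ : Fin k => s).filter
      fun h => (h i, h j) = (a, b)).card = s.card ^ k := by
  have e : ((Fintype.piFinset fun _ : Fin k => s).filter fun h => (h i, h j) = (a, b))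
      = Fintype.piFinset fun l => if l = i then {a} else if l = j then {b} else s := by
    ext h
    simp only [Finset.mem_filter, Fintype.mem_piFinset, Prod.mk.injEq]
    constructor
    · rintro ⟨h1, h2, h3⟩ l
      split_ifs with hi hj
      · simp [hi, h2]
      · simp [hj, h3]
      · exact h1 l
    · intro h1
      have h2 : h i = a := by simpa using h1 i
      have h3 : h j = b := by simpa [hij.symm] using h1 j
      refine ⟨fun l => ?_, h2, h3⟩
      by_cases hi : l = i
      · rw [hi, h2]; exact ha
      · by_cases hj : l = j
        · rw [hj, h3]; exact hb
        · simpa [hi, hj] using h1 l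
  rw [e, Fintype.card_piFinset]
  have h1 : ∀ m : Fin k, ∏ l, (if l = m then s.card else 1) = s.card := fun m => by simp
  calc _ = (∏ l, (if l = i then s.card else 1)) * (∏ l, (if l = j then s.card else 1))
        * ∏ l, (if l = i then ({a} : Finset ℕ) else if l = j then {b} else s).card := by
          rw [h1, h1, sq]
    _ = ∏ _l : Fin k, s.card := by
        rw [← Finset.prod_mul_distrib, ← Finset.prod_mul_distrib]
        refine Finset.prod_congr rfl fun l _ => ?_
        by_cases hi : l = i
        · have : l ≠ j := fun h => hij (hi.symm.trans h)
          simp [hi, hij]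
        · by_cases hj : l = j <;> simp [hi, hj, hij.symm]
    _ = _ := by simp

theorem sum_piFinset_pair {k : ℕ} {i j : Fin k} (hij : i ≠ j) (s : Finset ℕ) (F : ℕ × ℕ → ℝ) :
    (s.card : ℝ) ^ 2 * ∑ h ∈ Fintype.piFinset (fun _ : Fin k => s), F (h i, h j)
      = (s.card : ℝ) ^ k * ∑ x ∈ s ×ˢ s, F x := by
  rw [← Finset.sum_fiberwise_of_maps_to (t := s ×ˢ s) (g := fun h => (h i, h j))]
  · rw [Finset.mul_sum, Finset.mul_sum]
    refine Finset.sum_congr rfl fun x hx => ?_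
    have h1 : ∑ h ∈ (Fintype.piFinset fun _ : Fin k => s).filter (fun h => (h i, h j) = x),
        F (h i, h j) = ((Fintype.piFinset fun _ : Fin k => s).filter
          (fun h => (h i, h j) = x)).card * F x := by
      rw [← nsmul_eq_mul, ← Finset.sum_const]
      exact Finset.sum_congr rfl fun h hh => by rw [(Finset.mem_filter.1 hh).2]
    obtain ⟨a, b⟩ := x
    have hx' := Finset.mem_product.1 hx
    rw [h1, ← mul_assoc]
    congr 1
    exact_mod_cast card_filter_piFinset_pair hij hx'.1 hx'.2
  · intro h hh
    have := Fintype.mem_piFinset.1 hh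
    exact Finset.mem_product.2 ⟨this i, this j⟩

theorem modEq_prod_primes_iff {A : Finset ℕ} (hA : ∀ p ∈ A, p.Prime) (a b : ℕ) :
    a ≡ b [MOD ∏ p ∈ A, p] ↔ ∀ p ∈ A, a ≡ b [MOD p] := by
  constructor
  · exact fun h p hp => h.of_dvd (Finset.dvd_prod_of_mem _ hp)
  · intro h
    rw [Nat.modEq_iff_dvd]
    push_cast
    refine Finset.prod_dvd_of_coprime ?_ fun p hp => Nat.modEq_iff_dvd.1 (h p hp)
    intro p hp q hq hpq
    exact Nat.isCoprime_iff_coprime.2 ((Nat.coprime_primes (hA p hp) (hA q hq)).2 hpq)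

theorem card_modEq_pairs_le (H : ℕ) {d : ℕ} (hd : 0 < d) :
    (((Finset.Icc 1 H ×ˢ Finset.Icc 1 H).filter
      fun x => x.1 ≠ x.2 ∧ x.1 ≡ x.2 [MOD d]).card : ℝ) ≤ 2 * (H : ℝ) ^ 2 * (1 / d) := by
  have h1 : ((Finset.Icc 1 H ×ˢ Finset.Icc 1 H).filter
      fun x => x.1 ≠ x.2 ∧ x.1 ≡ x.2 [MOD d]).card
      ≤ (Finset.Icc 1 H ×ˢ (Finset.Icc (-(H / d : ℕ) : ℤ) (H / d : ℕ)).erase 0).card := by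
    refine Finset.card_le_card_of_injOn
      (fun x => (x.1, ((x.2 : ℤ) - x.1) / d)) ?_ ?_
    · rintro ⟨a, b⟩ hx
      simp only [Finset.coe_filter, Finset.mem_product, Finset.mem_Icc, Set.mem_ofPred_eq] at hx
      obtain ⟨⟨⟨ha1, ha2⟩, hb1, hb2⟩, hne, hmod⟩ := hx
      obtain ⟨q, hq⟩ := Nat.modEq_iff_dvd.1 hmod
      have hd' : (0 : ℤ) < d := by exact_mod_cast hd
      simp only [Finset.coe_product, Set.mem_prod, Finset.mem_coe, Finset.mem_Icc,
        Finset.mem_erase]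
      rw [hq, Int.mul_ediv_cancel_left _ hd'.ne']
      refine ⟨⟨ha1, ha2⟩, ?_, ?_, ?_⟩
      · rintro rfl
        apply hne
        have : (b : ℤ) - a = 0 := by simpa using hq
        omega
      · push_cast
        rw [neg_le, Int.le_ediv_iff_mul_le hd']
        nlinarith
      · push_cast
        rw [Int.le_ediv_iff_mul_le hd']
        nlinarith
    · rintro ⟨a, b⟩ hx ⟨a', b'⟩ hx' heq
      simp only [Finset.coe_filter, Set.mem_ofPred_eq] at hx hx'
      simp only [Prod.mk.injEq] at heq ⊢
      obtain ⟨rfl, h2⟩ := heq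
      have h3 := Int.ediv_left_inj (Nat.modEq_iff_dvd.1 hx.2.2) (Nat.modEq_iff_dvd.1 hx'.2.2)
      have := h3.1 h2
      refine ⟨rfl, by omega⟩
  rw [Finset.card_product, Finset.card_erase_of_mem (Finset.mem_Icc.2
    ⟨neg_nonpos.2 (Int.natCast_nonneg _), Int.natCast_nonneg _⟩), Int.card_Icc, Nat.card_Icc] at h1
  have h2 : ((H / d : ℕ) : ℝ) ≤ H / d := Nat.cast_div_le
  have h3 : (H + 1 - 1) * (((H / d : ℕ) + 1 - -((H / d : ℕ) : ℤ)).toNat - 1)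
      = H * (2 * (H / d)) := by
    congr 1
    omega
  rw [h3] at h1
  calc _ ≤ ((H * (2 * (H / d)) : ℕ) : ℝ) := by exact_mod_cast h1
    _ = 2 * H * ((H / d : ℕ) : ℝ) := by push_cast; ring
    _ ≤ 2 * H * (H / d) := by gcongr
    _ = _ := by ring

theorem sum_pairs_prod_one_add_le (H : ℕ) {Q : Finset ℕ} (hQ : ∀ p ∈ Q, p.Prime) {c : ℕ → ℝ}
    (hc : ∀ p ∈ Q, 0 ≤ c p) :
    ∑ x ∈ Finset.Icc 1 H ×ˢ Finset.Icc 1 H, (if x.1 = x.2 then (0 : ℝ) else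
      ∏ p ∈ Q, (1 + c p * if x.1 ≡ x.2 [MOD p] then 1 else 0))
      ≤ 2 * (H : ℝ) ^ 2 * ∏ p ∈ Q, (1 + c p * (1 / p)) := by
  have e : ∀ x : ℕ × ℕ, (if x.1 = x.2 then (0 : ℝ) else
      ∏ p ∈ Q, (1 + c p * if x.1 ≡ x.2 [MOD p] then 1 else 0))
      = ∑ A ∈ Q.powerset, (∏ p ∈ A, c p) *
        if x.1 ≠ x.2 ∧ x.1 ≡ x.2 [MOD ∏ p ∈ A, p] then 1 else 0 := by
    intro x
    by_cases hx : x.1 = x.2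
    · simp [hx]
    · rw [if_neg hx, Finset.prod_one_add]
      refine Finset.sum_congr rfl fun A hA => ?_
      rw [Finset.prod_mul_distrib, Finset.prod_ite_zero, Finset.prod_const_one]
      congr 1
      have := modEq_prod_primes_iff (fun p hp => hQ p (Finset.mem_powerset.1 hA hp)) x.1 x.2
      simp [hx, this]
  simp_rw [e]
  rw [Finset.sum_comm, Finset.prod_one_add, Finset.mul_sum]
  refine Finset.sum_le_sum fun A hA => ?_
  have hA' := Finset.mem_powerset.1 hA
  rw [← Finset.mul_sum, Finset.sum_boole, Finset.prod_mul_distrib]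
  have h1 := card_modEq_pairs_le H (d := ∏ p ∈ A, p)
    (Finset.prod_pos fun p hp => (hQ p (hA' hp)).pos)
  have h0 : 0 ≤ ∏ p ∈ A, c p := Finset.prod_nonneg fun p hp => hc p (hA' hp)
  have h2 : (1 / ((∏ p ∈ A, p : ℕ) : ℝ)) = ∏ p ∈ A, (1 / (p : ℝ)) := by
    push_cast
    simp
  rw [h2] at h1
  calc _ ≤ (∏ p ∈ A, c p) * (2 * (H : ℝ) ^ 2 * ∏ p ∈ A, (1 / (p : ℝ))) := by gcongr
    _ = _ := by ring

theorem tendsto_card_modEq_div (r c : ℕ) (hr : 0 < r) :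
    Tendsto (fun H : ℕ => (((Finset.Ioc 0 H).filter (· ≡ c [MOD r])).card : ℝ) / H)
      atTop (𝓝 (1 / r)) := by
  have hr' : (0 : ℝ) < r := by exact_mod_cast hr
  have hb : ∀ H : ℕ, |(((Finset.Ioc 0 H).filter (· ≡ c [MOD r])).card : ℝ) - H / r| ≤ 1 := by
    intro H
    have h1 := Nat.Ioc_filter_modEq_card 0 H hr c
    set m := ((Finset.Ioc 0 H).filter (· ≡ c [MOD r])).card
    have hmono : ⌊(((0 : ℕ) : ℚ) - c) / r⌋ ≤ ⌊((H : ℚ) - c) / r⌋ := by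
      apply Int.floor_le_floor
      gcongr
      exact Nat.zero_le _
    rw [max_eq_left (by omega)] at h1
    have h2 := Int.floor_le (((H : ℚ) - c) / r)
    have h3 := Int.lt_floor_add_one (((H : ℚ) - c) / r)
    have h4 := Int.floor_le ((((0 : ℕ) : ℚ) - c) / r)
    have h5 := Int.lt_floor_add_one ((((0 : ℕ) : ℚ) - c) / r)
    have h6 : (m : ℚ) = (⌊((H : ℚ) - c) / r⌋ : ℚ) - (⌊(((0 : ℕ) : ℚ) - c) / r⌋ : ℚ) := by
      exact_mod_cast h1
    have h7 : ((H : ℚ) - c) / r - (((0 : ℕ) : ℚ) - c) / r = H / r := by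
      push_cast; ring
    have h8 : |(m : ℚ) - H / r| ≤ 1 := by
      rw [abs_le]
      constructor <;> linarith
    have h9 : ((|(m : ℚ) - H / r| : ℚ) : ℝ) ≤ ((1 : ℚ) : ℝ) := Rat.cast_le.2 h8
    simpa using h9
  have h0 : Tendsto (fun H : ℕ => (1 : ℝ) / H) atTop (𝓝 0) := tendsto_one_div_atTop_nhds_zero_nat
  rw [tendsto_iff_dist_tendsto_zero]
  refine squeeze_zero' (Eventually.of_forall fun _ => dist_nonneg) ?_ h0
  filter_upwards [eventually_gt_atTop 0] with H hH
  have hH' : (0 : ℝ) < H := by exact_mod_cast hH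
  rw [Real.dist_eq]
  have e : (((Finset.Ioc 0 H).filter (· ≡ c [MOD r])).card : ℝ) / H - 1 / r
      = ((((Finset.Ioc 0 H).filter (· ≡ c [MOD r])).card : ℝ) - H / r) / H := by
    field_simp
  rw [e, abs_div, abs_of_pos hH']
  gcongr
  exact hb H

theorem tendsto_sieve_density {Q : Finset ℕ} (hQ : ∀ p ∈ Q, p.Prime) (a : ℕ → ℕ) :
    Tendsto (fun H : ℕ => (∑ n ∈ Finset.Icc 1 H,
      ∏ p ∈ Q, (if n ≡ a p [MOD p] then (0 : ℝ) else 1)) / H)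
      atTop (𝓝 (∏ p ∈ Q, (1 - 1 / (p : ℝ)))) := by
  have key : ∀ A ∈ Q.powerset, ∃ c : ℕ, ∀ n : ℕ,
      (∀ p ∈ A, n ≡ a p [MOD p]) ↔ n ≡ c [MOD ∏ p ∈ A, p] := by
    intro A hA
    have hA' := fun p hp => hQ p (Finset.mem_powerset.1 hA hp)
    obtain ⟨c, hc⟩ := Nat.chineseRemainderOfFinset a id A (fun p hp => (hA' p hp).ne_zero)
      (fun p hp q hq hpq => (Nat.coprime_primes (hA' p hp) (hA' q hq)).2 hpq)
    refine ⟨c, fun n => ?_⟩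
    rw [modEq_prod_primes_iff hA']
    exact forall₂_congr fun p hp =>
      ⟨fun h => h.trans (hc p hp).symm, fun h => h.trans (hc p hp)⟩
  choose! c hc using key
  have e : ∀ H : ℕ, (∑ n ∈ Finset.Icc 1 H,
      ∏ p ∈ Q, (if n ≡ a p [MOD p] then (0 : ℝ) else 1)) / H
      = ∑ A ∈ Q.powerset, (∏ _p ∈ A, (-1 : ℝ)) *
        ((((Finset.Ioc 0 H).filter (· ≡ c A [MOD ∏ p ∈ A, p])).card : ℝ) / H) := by
    intro H
    have e1 : ∀ n : ℕ, ∏ p ∈ Q, (if n ≡ a p [MOD p] then (0 : ℝ) else 1)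
        = ∑ A ∈ Q.powerset, (∏ _p ∈ A, (-1 : ℝ)) *
          if n ≡ c A [MOD ∏ p ∈ A, p] then 1 else 0 := by
      intro n
      have e2 : ∀ p, (if n ≡ a p [MOD p] then (0 : ℝ) else 1)
          = 1 + (-1) * if n ≡ a p [MOD p] then 1 else 0 := fun p => by split_ifs <;> norm_num
      simp_rw [e2]
      rw [Finset.prod_one_add]
      refine Finset.sum_congr rfl fun A hA => ?_
      rw [Finset.prod_mul_distrib, Finset.prod_ite_zero, Finset.prod_const_one]
      simp only [hc A hA n]
    simp_rw [e1]
    rw [Finset.sum_comm, Finset.sum_div]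
    refine Finset.sum_congr rfl fun A _ => ?_
    rw [← Finset.mul_sum, Finset.sum_boole, mul_div_assoc]
    rfl
  simp_rw [e]
  have e3 : ∏ p ∈ Q, (1 - 1 / (p : ℝ))
      = ∑ A ∈ Q.powerset, (∏ _p ∈ A, (-1 : ℝ)) * (1 / ((∏ p ∈ A, p : ℕ) : ℝ)) := by
    have : ∀ p : ℕ, 1 - 1 / (p : ℝ) = 1 + (-1) * (1 / (p : ℝ)) := fun p => by ring
    simp_rw [this]
    rw [Finset.prod_one_add]
    refine Finset.sum_congr rfl fun A _ => ?_
    rw [Finset.prod_mul_distrib]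
    push_cast
    simp
  rw [e3]
  refine tendsto_finsetSum _ fun A hA => (tendsto_card_modEq_div _ _ ?_).const_mul _
  exact Finset.prod_pos fun p hp => (hQ p (Finset.mem_powerset.1 hA hp)).pos

end Counting

section LocalAverages

theorem one_sub_nup_div_eq {k : ℕ} (h : Fin k → ℕ) {p : ℕ} (hp : p.Prime) :
    1 - (nup h p : ℝ) / p
      = (1 / (p : ℝ)) * ∑ a ∈ Finset.range p, ∏ i, (if h i ≡ a [MOD p] then (0 : ℝ) else 1) := by
  have hp0 : (p : ℝ) ≠ 0 := by exact_mod_cast hp.ne_zero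
  have : NeZero p := ⟨hp.ne_zero⟩
  have e1 : ∀ a, ∏ i, (if h i ≡ a [MOD p] then (0 : ℝ) else 1)
      = 1 - if ∃ i, h i ≡ a [MOD p] then 1 else 0 := by
    intro a
    split_ifs with hex
    · obtain ⟨i, hi⟩ := hex
      rw [Finset.prod_eq_zero (Finset.mem_univ i) (by simp [hi])]
      simp
    · push Not at hex
      simp [hex]
  have e2 : nup h p = ((Finset.range p).filter fun a => ∃ i, h i ≡ a [MOD p]).card := by
    unfold nup
    rw [← Set.ncard_coe_finset]
    symm
    refine Set.ncard_congr (fun (a : ℕ) _ => (a : ZMod p)) ?_ ?_ ?_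
    · intro a ha
      simp only [Finset.coe_filter, Set.mem_ofPred_eq] at ha
      obtain ⟨_, i, hi⟩ := ha
      exact ⟨i, (ZMod.natCast_eq_natCast_iff _ _ _).2 hi⟩
    · intro a b ha hb hab
      simp only [Finset.coe_filter, Set.mem_ofPred_eq, Finset.mem_range] at ha hb
      exact Nat.ModEq.eq_of_lt_of_lt ((ZMod.natCast_eq_natCast_iff _ _ _).1 hab) ha.1 hb.1
    · rintro _ ⟨i, rfl⟩
      refine ⟨h i % p, ?_, by simp⟩
      simp only [Finset.coe_filter, Set.mem_ofPred_eq, Finset.mem_range]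
      exact ⟨Nat.mod_lt _ hp.pos, i, (Nat.mod_modEq _ _).symm⟩
  simp_rw [e1]
  rw [Finset.sum_sub_distrib, Finset.sum_boole, e2]
  simp
  field_simp

theorem sum_prod_one_sub_nup_eq (k H : ℕ) {Q : Finset ℕ} (hQ : ∀ p ∈ Q, p.Prime) :
    ∑ h ∈ Fintype.piFinset (fun _ : Fin k => Finset.Icc 1 H), ∏ p ∈ Q, (1 - (nup h p : ℝ) / p)
      = (∏ p ∈ Q, (1 / (p : ℝ))) * ∑ a ∈ Fintype.piFinset (fun p : Q => Finset.range (p : ℕ)),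
        (∑ n ∈ Finset.Icc 1 H, ∏ p : Q, (if n ≡ a p [MOD p] then (0 : ℝ) else 1)) ^ k := by
  have e1 : ∀ h : Fin k → ℕ, ∏ p ∈ Q, (1 - (nup h p : ℝ) / p)
      = (∏ p ∈ Q, (1 / (p : ℝ))) * ∑ a ∈ Fintype.piFinset (fun p : Q => Finset.range (p : ℕ)),
        ∏ i, ∏ p : Q, (if h i ≡ a p [MOD p] then (0 : ℝ) else 1) := by
    intro h
    rw [Finset.prod_congr rfl fun p hp => one_sub_nup_div_eq h (hQ p hp),
      Finset.prod_mul_distrib]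
    congr 1
    rw [← Finset.prod_coe_sort Q, Finset.prod_univ_sum]
    exact Finset.sum_congr rfl fun a _ => Finset.prod_comm
  simp_rw [e1]
  rw [← Finset.mul_sum, Finset.sum_comm]
  congr 1
  refine Finset.sum_congr rfl fun a _ => ?_
  rw [← Finset.prod_univ_sum (fun _ => Finset.Icc 1 H)
    fun _ n => ∏ p : Q, (if n ≡ a p [MOD p] then (0 : ℝ) else 1)]
  simp

theorem tendsto_average_prod_one_sub_nup (k : ℕ) {Q : Finset ℕ} (hQ : ∀ p ∈ Q, p.Prime) :
    Tendsto (fun H : ℕ => (∑ h ∈ Fintype.piFinset (fun _ : Fin k => Finset.Icc 1 H),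
      ∏ p ∈ Q, (1 - (nup h p : ℝ) / p)) / (H : ℝ) ^ k)
      atTop (𝓝 (∏ p ∈ Q, (1 - 1 / (p : ℝ)) ^ k)) := by
  have hlim : ∏ p ∈ Q, (1 - 1 / (p : ℝ)) ^ k = (∏ p ∈ Q, (1 / (p : ℝ))) *
      ∑ _a ∈ Fintype.piFinset (fun p : Q => Finset.range (p : ℕ)),
        (∏ p ∈ Q, (1 - 1 / (p : ℝ))) ^ k := by
    rw [Finset.sum_const, Fintype.card_piFinset, nsmul_eq_mul, ← mul_assoc, Finset.prod_pow]
    have : (∏ p ∈ Q, (1 / (p : ℝ))) * ((∏ p : Q, (Finset.range (p : ℕ)).card : ℕ) : ℝ) = 1 := by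
      simp only [Finset.card_range]
      rw [Finset.prod_coe_sort Q fun p => p]
      push_cast
      rw [← Finset.prod_mul_distrib]
      refine Finset.prod_eq_one fun p hp => ?_
      have : (p : ℝ) ≠ 0 := by exact_mod_cast (hQ p hp).ne_zero
      field_simp
    rw [this, one_mul]
  rw [hlim]
  simp_rw [sum_prod_one_sub_nup_eq k _ hQ, mul_div_assoc, Finset.sum_div, ← div_pow]
  refine (tendsto_finsetSum _ fun a _ => ?_).const_mul _
  refine Tendsto.pow ?_ k
  have := tendsto_sieve_density hQ fun p => if hp : p ∈ Q then a ⟨p, hp⟩ else 0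
  refine this.congr fun H => ?_
  congr 1
  refine Finset.sum_congr rfl fun n _ => ?_
  rw [← Finset.prod_coe_sort Q]
  simp

theorem tendsto_average_prod_singFactor (k : ℕ) {Q : Finset ℕ} (hQ : ∀ p ∈ Q, p.Prime) :
    Tendsto (fun H : ℕ => (∑ h ∈ Fintype.piFinset (fun _ : Fin k => Finset.Icc 1 H),
      ∏ p ∈ Q, singFactor h p) / (H : ℝ) ^ k) atTop (𝓝 1) := by
  have hne : ∀ p ∈ Q, 1 - 1 / (p : ℝ) ≠ 0 := fun p hp => by
    have := one_div_prime_le_half (hQ p hp)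
    linarith
  have h1 := (tendsto_average_prod_one_sub_nup k hQ).const_mul
    (∏ p ∈ Q, (1 - 1 / (p : ℝ)) ^ (-(k : ℤ)))
  have hone : ∏ p ∈ Q, (1 - 1 / (p : ℝ)) ^ (-(k : ℤ)) * (1 - 1 / (p : ℝ)) ^ k = 1 :=
    Finset.prod_eq_one fun p hp => by
      rw [zpow_neg, zpow_natCast, inv_mul_cancel₀ (pow_ne_zero _ (hne p hp))]
  rw [← Finset.prod_mul_distrib, hone] at h1
  refine h1.congr fun H => ?_
  rw [← mul_div_assoc, Finset.mul_sum]
  congr 1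
  refine Finset.sum_congr rfl fun h _ => ?_
  unfold singFactor
  rw [Finset.prod_mul_distrib, mul_comm]

theorem abs_prod_singFactor_le {k : ℕ} (h : Fin k → ℕ) {Q : Finset ℕ} (hQ : ∀ p ∈ Q, p.Prime) :
    |∏ p ∈ Q, singFactor h p| ≤ (1 + 2 ^ k * k) ^ Q.card := by
  rw [Finset.abs_prod, ← Finset.prod_const]
  refine Finset.prod_le_prod (fun _ _ => abs_nonneg _) fun p hp => ?_
  have h1 := abs_singFactor_sub_one_le h (hQ p hp)
  have h2 := one_div_prime_le_half (hQ p hp)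
  have h3 := abs_add_le (singFactor h p - 1) 1
  have h4 : 2 ^ k * (k : ℝ) * (1 / (p : ℝ)) ≤ 2 ^ k * k * 1 := by gcongr; linarith
  rw [sub_add_cancel, abs_one] at h3
  linarith

theorem card_not_injective_le (k H : ℕ) :
    (((Fintype.piFinset fun _ : Fin k => Finset.Icc 1 H).filter
      fun h => ¬ Function.Injective h).card : ℝ) * H ≤ (k : ℝ) ^ 2 * (H : ℝ) ^ k := by
  rcases Nat.eq_zero_or_pos H with rfl | hH
  · simp only [Nat.cast_zero, mul_zero]
    positivity
  have hH' : (0 : ℝ) < H := by exact_mod_cast hH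
  have h1 : (((Fintype.piFinset fun _ : Fin k => Finset.Icc 1 H).filter
      fun h => ¬ Function.Injective h).card : ℝ)
      ≤ ∑ e ∈ (Finset.univ : Finset (Fin k)).offDiag,
        ∑ h ∈ Fintype.piFinset (fun _ : Fin k => Finset.Icc 1 H),
          if h e.1 = h e.2 then (1 : ℝ) else 0 := by
    rw [Finset.sum_comm, ← Finset.sum_boole]
    refine Finset.sum_le_sum fun h _ => ?_
    have hnn : ∀ e ∈ (Finset.univ : Finset (Fin k)).offDiag,
        0 ≤ if h e.1 = h e.2 then (1 : ℝ) else 0 := fun e _ => by positivity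
    by_cases hinj : Function.Injective h
    · simp [hinj]
    · rw [if_pos hinj]
      rw [Function.Injective] at hinj
      push Not at hinj
      obtain ⟨i, j, hij, hne⟩ := hinj
      have := Finset.single_le_sum hnn (a := (i, j)) (by simpa using hne)
      simpa [hij] using this
  have h2 : ∀ e ∈ (Finset.univ : Finset (Fin k)).offDiag,
      (∑ h ∈ Fintype.piFinset (fun _ : Fin k => Finset.Icc 1 H),
          if h e.1 = h e.2 then (1 : ℝ) else 0) = (H : ℝ) ^ k / H := by
    intro e he
    have h3 := sum_piFinset_pair (Finset.mem_offDiag.1 he).2.2 (Finset.Icc 1 H)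
      fun x => if x.1 = x.2 then (1 : ℝ) else 0
    have h4 : ∑ x ∈ Finset.Icc 1 H ×ˢ Finset.Icc 1 H, (if x.1 = x.2 then (1 : ℝ) else 0) = H := by
      rw [Finset.sum_product]
      have : ∀ a ∈ Finset.Icc 1 H, ∑ b ∈ Finset.Icc 1 H, (if a = b then (1 : ℝ) else 0) = 1 :=
        fun a ha => by rw [Finset.sum_ite_eq, if_pos ha]
      rw [Finset.sum_congr rfl this]
      simp
    rw [h4, Nat.card_Icc, Nat.add_sub_cancel] at h3
    rw [eq_div_iff hH'.ne']
    apply mul_left_cancel₀ hH'.ne'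
    linear_combination h3
  rw [Finset.sum_congr rfl h2, Finset.sum_const, nsmul_eq_mul] at h1
  have h5 : (((Finset.univ : Finset (Fin k)).offDiag.card : ℕ) : ℝ) ≤ (k : ℝ) ^ 2 := by
    have : (Finset.univ : Finset (Fin k)).offDiag.card ≤ k ^ 2 := by
      rw [Finset.offDiag_card, Finset.card_univ, Fintype.card_fin, sq]
      exact Nat.sub_le _ _
    exact_mod_cast this
  calc _ ≤ ((k : ℝ) ^ 2 * ((H : ℝ) ^ k / H)) * H := by
        gcongr
        exact h1.trans (by gcongr)
    _ = _ := by field_simp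

theorem tendsto_average_distinct_prod_singFactor (k : ℕ) {Q : Finset ℕ}
    (hQ : ∀ p ∈ Q, p.Prime) :
    Tendsto (fun H : ℕ => (∑ h ∈ distinctTuples k H, ∏ p ∈ Q, singFactor h p) / (H : ℝ) ^ k)
      atTop (𝓝 1) := by
  set B : ℝ := (1 + 2 ^ k * k) ^ Q.card with hB
  have h0 : Tendsto (fun H : ℕ => B * (k : ℝ) ^ 2 / H) atTop (𝓝 0) :=
    tendsto_const_div_atTop_nhds_zero_nat _
  have hdiff : Tendsto (fun H : ℕ =>
      (∑ h ∈ (Fintype.piFinset fun _ : Fin k => Finset.Icc 1 H).filter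
        (fun h => ¬ Function.Injective h), ∏ p ∈ Q, singFactor h p) / (H : ℝ) ^ k)
      atTop (𝓝 0) := by
    refine squeeze_zero_norm' ?_ h0
    filter_upwards [eventually_gt_atTop 0] with H hH
    have hH' : (0 : ℝ) < H := by exact_mod_cast hH
    have hcard := card_not_injective_le k H
    rw [norm_div, Real.norm_of_nonneg (by positivity : 0 ≤ (H : ℝ) ^ k), div_le_div_iff₀
      (by positivity) hH']
    have h1 := norm_sum_le_of_le (f := fun h : Fin k → ℕ => ∏ p ∈ Q, singFactor h p)
      ((Fintype.piFinset fun _ : Fin k => Finset.Icc 1 H).filter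
        (fun h => ¬ Function.Injective h)) fun h _ => abs_prod_singFactor_le h hQ
    rw [Finset.sum_const, nsmul_eq_mul, ← hB] at h1
    have hB0 : 0 ≤ B := by positivity
    calc _ ≤ _ := mul_le_mul_of_nonneg_right h1 hH'.le
      _ = B * (_ * (H : ℝ)) := by ring
      _ ≤ B * _ := mul_le_mul_of_nonneg_left hcard hB0
      _ = _ := by ring
  have := (tendsto_average_prod_singFactor k hQ).sub hdiff
  rw [sub_zero] at this
  refine this.congr fun H => ?_
  rw [← sub_div, distinctTuples, ← Finset.sum_filter_add_sum_filter_not _ Function.Injective,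
    add_sub_cancel_right]

end LocalAverages

section TruncationError

theorem one_add_sqrt_mul_abs_le {k : ℕ} (h : Fin k → ℕ) {p : ℕ} (hp : p.Prime) :
    1 + √p * |singFactor h p - 1|
      ≤ (1 + 2 ^ k * k ^ 2 * (1 / (p * √p))) * ∏ e ∈ (Finset.univ : Finset (Fin k)).offDiag,
        (1 + 2 ^ k * k * ((1 / √p) * if h e.1 ≡ h e.2 [MOD p] then 1 else 0)) := by
  have hp0 : (0 : ℝ) < p := by exact_mod_cast hp.pos
  have hs : 0 < √(p : ℝ) := Real.sqrt_pos.2 hp0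
  have hss : √(p : ℝ) * √p = p := Real.mul_self_sqrt hp0.le
  have hnn : ∀ e ∈ (Finset.univ : Finset (Fin k)).offDiag,
      0 ≤ 2 ^ k * (k : ℝ) * ((1 / √p) * if h e.1 ≡ h e.2 [MOD p] then 1 else 0) :=
    fun e _ => by positivity
  have h1 := one_le_prod_one_add _ _ hnn
  by_cases hinj : ∀ i j, i ≠ j → ¬ h i ≡ h j [MOD p]
  · have h2 := abs_singFactor_sub_one_le_of_injective h hp hinj
    have h3 : √(p : ℝ) * (2 ^ k * k ^ 2 * (1 / (p : ℝ)) ^ 2)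
        = 2 ^ k * k ^ 2 * (1 / (p * √p)) := by
      nth_rewrite 2 3 [← hss]
      field_simp
    have h4 := mul_le_mul_of_nonneg_left h2 hs.le
    have h5 : 0 ≤ 2 ^ k * (k : ℝ) ^ 2 * (1 / (p * √p)) := by positivity
    calc 1 + √p * |singFactor h p - 1| ≤ 1 + 2 ^ k * k ^ 2 * (1 / (p * √p)) := by linarith
      _ ≤ _ := le_mul_of_one_le_right (by linarith) h1
  · push Not at hinj
    obtain ⟨i, j, hne, hij⟩ := hinj
    have h2 := mul_le_mul_of_nonneg_left (abs_singFactor_sub_one_le h hp) hs.le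
    have h3 : √(p : ℝ) * (2 ^ k * k * (1 / (p : ℝ))) = 2 ^ k * k * (1 / √p) := by
      rw [← hss, Real.sqrt_mul_self hs.le]
      field_simp
    have h4 := one_add_sum_le_prod_one_add _ _ hnn
    have h5 := Finset.single_le_sum hnn (a := (i, j)) (by simpa using hne)
    simp only [hij, if_true, mul_one] at h5
    have h6 : 0 ≤ 2 ^ k * (k : ℝ) ^ 2 * (1 / (p * √p)) := by positivity
    calc 1 + √p * |singFactor h p - 1| ≤ 1 + 2 ^ k * k * (1 / √p) := by linarith
      _ ≤ _ := by linarith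
      _ ≤ _ := le_mul_of_one_le_left (by linarith) (by linarith)

theorem exists_prod_one_add_le (C : ℝ) (hC : 0 ≤ C) :
    ∃ K : ℝ, 0 < K ∧ ∀ Q : Finset ℕ, ∏ p ∈ Q, (1 + C * (1 / ((p : ℝ) * √p))) ≤ K := by
  have hs : Summable fun p : ℕ => C * (1 / ((p : ℝ) * √p)) := by
    have h1 : Summable fun p : ℕ => 1 / (p : ℝ) ^ (3 / 2 : ℝ) :=
      Real.summable_one_div_nat_rpow.2 (by norm_num)
    refine (h1.congr fun p => ?_).mul_left C
    rcases Nat.eq_zero_or_pos p with rfl | hp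
    · norm_num
    · have hp0 : (0 : ℝ) < p := by exact_mod_cast hp
      rw [show (3 / 2 : ℝ) = 1 + 1 / 2 by norm_num, Real.rpow_add hp0, Real.rpow_one,
        Real.sqrt_eq_rpow]
  refine ⟨Real.exp (∑' p : ℕ, C * (1 / ((p : ℝ) * √p))), Real.exp_pos _, fun Q => ?_⟩
  refine (Real.prod_one_add_le_exp_sum Q fun p => by positivity).trans ?_
  exact Real.exp_le_exp.2 (hs.sum_le_tsum Q fun p _ => by positivity)

theorem exists_sum_weight_le (k : ℕ) : ∃ K : ℝ, 0 ≤ K ∧ ∀ (H : ℕ) (Q : Finset ℕ), 0 < H →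
    (∀ p ∈ Q, p.Prime) → ∑ h ∈ distinctTuples k H,
      ∏ p ∈ Q, (1 + √p * |singFactor h p - 1|) ≤ K * (H : ℝ) ^ k := by
  set P := (Finset.univ : Finset (Fin k)).offDiag with hP
  set C : ℝ := (1 + 2 ^ k * k) ^ P.card with hC
  have hC0 : 0 ≤ C := by positivity
  obtain ⟨K₁, hK₁, h₁⟩ := exists_prod_one_add_le (2 ^ k * k ^ 2) (by positivity)
  obtain ⟨K₂, hK₂, h₂⟩ := exists_prod_one_add_le C hC0
  refine ⟨K₁ * (1 + P.card * (2 * K₂)), by positivity, fun H Q hH hQ => ?_⟩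
  have hH' : (0 : ℝ) < H := by exact_mod_cast hH
  set F : ℕ × ℕ → ℝ := fun x => if x.1 = x.2 then (0 : ℝ) else
      ∏ p ∈ Q, (1 + C * (1 / √p) * if x.1 ≡ x.2 [MOD p] then 1 else 0) with hF
  have hF0 : ∀ x, 0 ≤ F x := fun x => by
    simp only [hF]
    split_ifs
    · exact le_rfl
    · exact Finset.prod_nonneg fun p _ => by positivity
  have hpt : ∀ h ∈ distinctTuples k H, ∏ p ∈ Q, (1 + √p * |singFactor h p - 1|)
      ≤ K₁ * (1 + ∑ e ∈ P, F (h e.1, h e.2)) := by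
    intro h hh
    have hinj : Function.Injective h := (Finset.mem_filter.1 hh).2
    calc ∏ p ∈ Q, (1 + √p * |singFactor h p - 1|)
        ≤ ∏ p ∈ Q, ((1 + 2 ^ k * k ^ 2 * (1 / (p * √p))) * ∏ e ∈ P,
          (1 + 2 ^ k * k * ((1 / √p) * if h e.1 ≡ h e.2 [MOD p] then 1 else 0))) :=
          Finset.prod_le_prod (fun p _ => by positivity)
            fun p hp => one_add_sqrt_mul_abs_le h (hQ p hp)
      _ = (∏ p ∈ Q, (1 + 2 ^ k * (k : ℝ) ^ 2 * (1 / (p * √p)))) * ∏ e ∈ P, ∏ p ∈ Q,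
          (1 + 2 ^ k * k * ((1 / √p) * if h e.1 ≡ h e.2 [MOD p] then 1 else 0)) := by
          rw [Finset.prod_mul_distrib, Finset.prod_comm]
      _ ≤ K₁ * (1 + ∑ e ∈ P, (∏ p ∈ Q, (1 + 2 ^ k * (k : ℝ) *
          ((1 / √p) * if h e.1 ≡ h e.2 [MOD p] then 1 else 0))) ^ P.card) := by
          refine mul_le_mul (h₁ Q) (prod_le_one_add_sum_pow P _ fun e _ => ?_)
            (Finset.prod_nonneg fun e _ => Finset.prod_nonneg fun p _ => by positivity) hK₁.le
          exact one_le_prod_one_add _ _ fun p _ => by positivity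
      _ ≤ K₁ * (1 + ∑ e ∈ P, F (h e.1, h e.2)) := by
          gcongr with e he
          have hne : h e.1 ≠ h e.2 := fun hc => (Finset.mem_offDiag.1 he).2.2 (hinj hc)
          simp only [hF, if_neg hne]
          rw [← Finset.prod_pow]
          refine Finset.prod_le_prod (fun p _ => by positivity) fun p hp => ?_
          rw [mul_assoc C]
          refine one_add_mul_pow_le (by positivity) (by positivity) ?_ _
          have hp1 : 1 / √(p : ℝ) ≤ 1 := by
            rw [div_le_one (Real.sqrt_pos.2 (by exact_mod_cast (hQ p hp).pos))]
            exact Real.one_le_sqrt.2 (by exact_mod_cast (hQ p hp).one_le)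
          split_ifs
          · simpa using hp1
          · simp
  have hpair : ∀ e ∈ P, ∑ h ∈ Fintype.piFinset (fun _ : Fin k => Finset.Icc 1 H),
      F (h e.1, h e.2) ≤ 2 * K₂ * (H : ℝ) ^ k := by
    intro e he
    have h3 := sum_piFinset_pair (Finset.mem_offDiag.1 he).2.2 (Finset.Icc 1 H) F
    have h4 := sum_pairs_prod_one_add_le H hQ (c := fun p => C * (1 / √p))
      fun p _ => by positivity
    have h5 : ∏ p ∈ Q, (1 + C * (1 / √(p : ℝ)) * (1 / p)) ≤ K₂ := by
      refine le_trans (le_of_eq (Finset.prod_congr rfl fun p _ => ?_)) (h₂ Q)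
      rw [mul_comm (p : ℝ), mul_assoc, one_div_mul_one_div]
    rw [Nat.card_Icc, Nat.add_sub_cancel] at h3
    have h6 : ∑ x ∈ Finset.Icc 1 H ×ˢ Finset.Icc 1 H, F x ≤ 2 * (H : ℝ) ^ 2 * K₂ :=
      h4.trans (by gcongr)
    have h7 : (0 : ℝ) < (H : ℝ) ^ 2 := by positivity
    refine le_of_mul_le_mul_left ?_ h7
    rw [h3]
    calc _ ≤ (H : ℝ) ^ k * (2 * (H : ℝ) ^ 2 * K₂) := by gcongr
      _ = _ := by ring
  calc _ ≤ ∑ h ∈ distinctTuples k H, K₁ * (1 + ∑ e ∈ P, F (h e.1, h e.2)) :=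
        Finset.sum_le_sum hpt
    _ ≤ ∑ h ∈ Fintype.piFinset (fun _ : Fin k => Finset.Icc 1 H),
        K₁ * (1 + ∑ e ∈ P, F (h e.1, h e.2)) := by
        refine Finset.sum_le_sum_of_subset_of_nonneg (Finset.filter_subset _ _) fun h _ _ => ?_
        have := Finset.sum_nonneg fun e (_ : e ∈ P) => hF0 (h e.1, h e.2)
        positivity
    _ = K₁ * ((H : ℝ) ^ k + ∑ e ∈ P, ∑ h ∈ Fintype.piFinset (fun _ : Fin k => Finset.Icc 1 H),
        F (h e.1, h e.2)) := by
        rw [← Finset.mul_sum, Finset.sum_add_distrib, Finset.sum_comm]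
        simp
    _ ≤ K₁ * ((H : ℝ) ^ k + ∑ _e ∈ P, 2 * K₂ * (H : ℝ) ^ k) := by
        gcongr with e he
        exact hpair e he
    _ = _ := by
        rw [Finset.sum_const, nsmul_eq_mul]
        ring

theorem exists_truncation_error_le (k : ℕ) : ∃ K : ℝ, 0 ≤ K ∧ ∀ (H N : ℕ), 0 < H → 1 ≤ N →
    |∑ h ∈ distinctTuples k H, singSeries h
      - ∑ h ∈ distinctTuples k H, ∏ p ∈ N.primesBelow, singFactor h p|
      ≤ K * (H : ℝ) ^ k / √N := by
  obtain ⟨K, hK, hw⟩ := exists_sum_weight_le k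
  refine ⟨K, hK, fun H N hH hN => ?_⟩
  have hN1 : 1 ≤ √(N : ℝ) := Real.one_le_sqrt.2 (by exact_mod_cast hN)
  have hlim : Tendsto (fun N' : ℕ => |∑ h ∈ distinctTuples k H,
      ∏ p ∈ N'.primesBelow, singFactor h p
      - ∑ h ∈ distinctTuples k H, ∏ p ∈ N.primesBelow, singFactor h p|) atTop
      (𝓝 |∑ h ∈ distinctTuples k H, singSeries h
      - ∑ h ∈ distinctTuples k H, ∏ p ∈ N.primesBelow, singFactor h p|) := by
    refine ((tendsto_finsetSum _ fun h hh => ?_).sub_const _).abs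
    exact tendsto_prod_primesBelow_singFactor h (Finset.mem_filter.1 hh).2
  refine le_of_tendsto hlim ?_
  filter_upwards [eventually_ge_atTop N] with N' hN'
  have hsub : N.primesBelow ⊆ N'.primesBelow := fun p hp =>
    Nat.mem_primesBelow.2 ⟨(Nat.lt_of_mem_primesBelow hp).trans_le hN',
      Nat.prime_of_mem_primesBelow hp⟩
  rw [le_div_iff₀ (by linarith), ← Finset.sum_sub_distrib]
  refine le_trans ?_ (hw H N'.primesBelow hH fun p => Nat.prime_of_mem_primesBelow)
  rw [mul_comm]
  calc _ ≤ √(N : ℝ) * ∑ h ∈ distinctTuples k H, |∏ p ∈ N'.primesBelow, singFactor h p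
        - ∏ p ∈ N.primesBelow, singFactor h p| := by
        gcongr
        exact Finset.abs_sum_le_sum_abs _ _
    _ ≤ _ := by
        rw [Finset.mul_sum]
        refine Finset.sum_le_sum fun h _ => ?_
        refine abs_prod_sub_prod_subset_le hsub (singFactor h) _ hN1 (fun p hp => ?_)
          fun p hp hpN => ?_
        · refine le_mul_of_one_le_left (abs_nonneg _) (Real.one_le_sqrt.2 ?_)
          exact_mod_cast (Nat.prime_of_mem_primesBelow hp).one_le
        · gcongr
          by_contra hlt
          exact hpN (Nat.mem_primesBelow.2 ⟨not_le.1 hlt, Nat.prime_of_mem_primesBelow hp⟩)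

end TruncationError

/-- Gallagher's theorem: for every fixed `k ≥ 1`, the average of the singular series
over `k`-tuples of distinct positive integers with entries at most `H` tends to `1`. -/
theorem gallagher (k : ℕ) (hk : 1 ≤ k) :
    Tendsto (fun H : ℕ => (∑ h ∈ distinctTuples k H, singSeries h) / (H : ℝ) ^ k)
      atTop (𝓝 1) := by
  obtain ⟨K, hK, herr⟩ := exists_truncation_error_le k
  have hsmall : Tendsto (fun N : ℕ => K / √(N : ℝ)) atTop (𝓝 0) :=
    (Real.tendsto_sqrt_atTop.comp tendsto_natCast_atTop_atTop).const_div_atTop K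
  rw [Metric.tendsto_atTop]
  intro ε hε
  obtain ⟨N, hN, hN1⟩ := ((hsmall.eventually (gt_mem_nhds (half_pos hε))).and
    (eventually_ge_atTop 1)).exists
  have havg := tendsto_average_distinct_prod_singFactor k
    (Q := N.primesBelow) fun p => Nat.prime_of_mem_primesBelow
  obtain ⟨H₀, hH₀⟩ := Metric.tendsto_atTop.1 havg (ε / 2) (half_pos hε)
  refine ⟨max H₀ 1, fun H hH => ?_⟩
  have hHpos : 0 < H := (le_max_right H₀ 1).trans hH
  have hH' : (0 : ℝ) < (H : ℝ) ^ k := by positivity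
  refine (dist_triangle _ _ _).trans_lt
    ((add_lt_add_of_le_of_lt ?_ (hH₀ H ((le_max_left H₀ 1).trans hH))).trans_eq (add_halves ε))
  rw [Real.dist_eq, ← sub_div, abs_div, abs_of_pos hH', div_le_iff₀ hH']
  refine (herr H N hHpos hN1).trans ?_
  rw [mul_div_right_comm]
  gcongr
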